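/- arXiv:1701.07363 — 2 statements merged into one kernel-verified Lean document; each statement's English description precedes it below -/
import Mathlib

section
/- Under the hypotheses of the per-frame key inequality — q(t+1) = max(q(t) + y(t), 0) for all t, q(t₀) = 0, V ≥ 0, C ≥ 0, J ≥ 1, y_max ≥ 0, U ≥ (1/2)·y_max², for every t₀ ≤ t < t₀+J: V·d(t) + q(t)·y(t) ≤ V·d°(t) + q(t)·y°(t) + C, |y(t)| ≤ y_max, |y°(t)| ≤ y_max, ∑_{t=t₀}^{t₀+J−1} y°(t) ≤ 0, ∑_{t=t₀}^{t₀+J−1} d°(t) = J·D* — and assuming additionally d(t) ≥ 0 for all t in the frame, the end-of-frame queue length satisfies q(t₀+J) ≤ √(2·U·J·(J+1) + 2·C·J + 2·V·J·D*). -/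
/-- A virtual queue that starts empty grows by at most `b` per period. -/
theorem virtual_queue_mem_Icc {q y : ℕ → ℝ} {t₀ J : ℕ} {b : ℝ}
    (hrec : ∀ t, q (t + 1) = max (q t + y t) 0) (h0 : q t₀ = 0) (hb : 0 ≤ b)
    (hy : ∀ t, t₀ ≤ t → t < t₀ + J → y t ≤ b) {k : ℕ} (hk : k ≤ J) :
    q (t₀ + k) ∈ Set.Icc 0 (k * b) := by
  induction k with
  | zero => simp [h0]
  | succ k ih =>
    have hq := (ih (by omega)).2
    have hyk := hy (t₀ + k) (by omega) (by omega)
    rw [← add_assoc, hrec]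
    refine ⟨le_max_right _ _, max_le ?_ (by positivity)⟩
    push_cast
    linarith

/-- One-period drift bound for the quadratic Lyapunov function of a virtual queue. -/
theorem sq_max_add_zero_le (a b : ℝ) : (max (a + b) 0) ^ 2 ≤ a ^ 2 + 2 * (a * b) + b ^ 2 := by
  rcases max_cases (a + b) 0 with ⟨h, _⟩ | ⟨h, _⟩ <;> rw [h] <;> nlinarith [sq_nonneg (a + b)]

/-- Accumulated drift of a virtual queue over the first `k` periods of a frame. -/
theorem virtual_queue_sq_le {y q d dstar ystar : ℕ → ℝ} {t₀ J : ℕ} {V C b U : ℝ}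
    (hrec : ∀ t, q (t + 1) = max (q t + y t) 0) (h0 : q t₀ = 0) (hV : 0 ≤ V) (hb : 0 ≤ b)
    (hU : (1 / 2) * b ^ 2 ≤ U)
    (hdec : ∀ t, t₀ ≤ t → t < t₀ + J →
      V * d t + q t * y t ≤ V * dstar t + q t * ystar t + C)
    (hy : ∀ t, t₀ ≤ t → t < t₀ + J → |y t| ≤ b ∧ |ystar t| ≤ b)
    (hd : ∀ t, t₀ ≤ t → t < t₀ + J → 0 ≤ d t) {k : ℕ} (hk : k ≤ J) :
    q (t₀ + k) ^ 2 ≤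
      2 * (U * k ^ 2 + C * k + V * ∑ t ∈ Finset.Ico t₀ (t₀ + k), dstar t) := by
  induction k with
  | zero => simp [h0]
  | succ k ih =>
    have hlo : t₀ ≤ t₀ + k := by omega
    have hhi : t₀ + k < t₀ + J := by omega
    have hq := virtual_queue_mem_Icc hrec h0 hb
      (fun t h₁ h₂ => (le_abs_self _).trans (hy t h₁ h₂).1) (k := k) (by omega)
    obtain ⟨hyk, hysk⟩ := hy _ hlo hhi
    have hysq : y (t₀ + k) ^ 2 ≤ b ^ 2 := sq_le_sq' (abs_le.mp hyk).1 (abs_le.mp hyk).2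
    have hcross : q (t₀ + k) * ystar (t₀ + k) ≤ k * (2 * U) := calc
      q (t₀ + k) * ystar (t₀ + k) ≤ q (t₀ + k) * b :=
        mul_le_mul_of_nonneg_left (abs_le.mp hysk).2 hq.1
      _ ≤ k * b * b := mul_le_mul_of_nonneg_right hq.2 hb
      _ = k * b ^ 2 := by ring
      _ ≤ k * (2 * U) := mul_le_mul_of_nonneg_left (by linarith) k.cast_nonneg
    have hVd := mul_nonneg hV (hd _ hlo hhi)
    have hdrift := sq_max_add_zero_le (q (t₀ + k)) (y (t₀ + k))
    rw [← add_assoc, Finset.sum_Ico_succ_top hlo, hrec]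
    push_cast
    linarith [ih (by omega), hdec _ hlo hhi]

/-- **End-of-frame queue bound** (eq. (23) in the appendix). Under the hypotheses of the
per-frame key inequality, and assuming the online delay costs are nonnegative, the
end-of-frame queue length satisfies `q(t₀+J) ≤ √(2·U·J·(J+1) + 2·C·J + 2·V·J·D*)`. -/
theorem end_of_frame_queue_bound
    (y q d dstar ystar : ℕ → ℝ)
    (hrec : ∀ t, q (t + 1) = max (q t + y t) 0)
    (t₀ : ℕ) (h0 : q t₀ = 0)
    (V C : ℝ) (hV : 0 ≤ V) (hC : 0 ≤ C)
    (J : ℕ) (hJ : 1 ≤ J)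
    (Dstar y_max U : ℝ) (hy_max : 0 ≤ y_max) (hU : (1 / 2) * y_max ^ 2 ≤ U)
    (hdec : ∀ t, t₀ ≤ t → t < t₀ + J →
      V * d t + q t * y t ≤ V * dstar t + q t * ystar t + C)
    (hy : ∀ t, t₀ ≤ t → t < t₀ + J → |y t| ≤ y_max ∧ |ystar t| ≤ y_max)
    (hbudget : ∑ t ∈ Finset.Ico t₀ (t₀ + J), ystar t ≤ 0)
    (hDstar : ∑ t ∈ Finset.Ico t₀ (t₀ + J), dstar t = J * Dstar)
    (hd : ∀ t, t₀ ≤ t → t < t₀ + J → 0 ≤ d t) :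
    q (t₀ + J) ≤ Real.sqrt (2 * U * J * (J + 1) + 2 * C * J + 2 * V * J * Dstar) := by
  have hsq := virtual_queue_sq_le hrec h0 hV hy_max hU hdec hy hd le_rfl
  rw [hDstar] at hsq
  have hUJ : 0 ≤ U * J := mul_nonneg (le_trans (by positivity) hU) J.cast_nonneg
  exact Real.le_sqrt_of_sq_le (by linarith)
end

section
/- Under the hypotheses of the per-frame key inequality — q(t+1) = max(q(t) + y(t), 0) for all t, q(t₀) = 0, V > 0, C ≥ 0, J ≥ 1, y_max ≥ 0, U ≥ (1/2)·y_max², for every t₀ ≤ t < t₀+J: V·d(t) + q(t)·y(t) ≤ V·d°(t) + q(t)·y°(t) + C, |y(t)| ≤ y_max, |y°(t)| ≤ y_max, ∑_{t=t₀}^{t₀+J−1} y°(t) ≤ 0, ∑_{t=t₀}^{t₀+J−1} d°(t) = J·D* — the per-frame accumulated delay cost of the online algorithm satisfies ∑_{t=t₀}^{t₀+J−1} d(t) ≤ J·D* + (U·J·(J+1) + C·J)/V. -/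
/-- A virtual queue that starts empty and whose increments are bounded by `b` has backlog in
`[0, n * b]` after `n` steps. -/
theorem virtualQueue_mem_Icc {y q : ℕ → ℝ} (hrec : ∀ t, q (t + 1) = max (q t + y t) 0)
    {t₀ : ℕ} (h0 : q t₀ = 0) {b : ℝ} (hb : 0 ≤ b) (n : ℕ)
    (hy : ∀ t, t₀ ≤ t → t < t₀ + n → y t ≤ b) :
    q (t₀ + n) ∈ Set.Icc 0 (n * b) := by
  induction n with
  | zero => simp [h0]
  | succ n ih =>
    have hq := (ih fun t h₁ h₂ => hy t h₁ (by omega)).2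
    have hyn := hy (t₀ + n) (by omega) (by omega)
    rw [← add_assoc, hrec]
    refine ⟨le_max_right _ _, max_le ?_ (by positivity)⟩
    push_cast
    linarith

/-- One-step quadratic drift of the virtual queue. -/
theorem max_add_zero_sq_le (a b : ℝ) : max (a + b) 0 ^ 2 ≤ a ^ 2 + 2 * (a * b) + b ^ 2 := by
  rcases max_cases (a + b) 0 with ⟨h, -⟩ | ⟨h, -⟩ <;> rw [h] <;> nlinarith [sq_nonneg (a + b)]

/-- Drift-plus-penalty bound over `n` steps of a virtual queue that starts empty. -/
theorem drift_plus_penalty_le {y q d dstar ystar : ℕ → ℝ}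
    (hrec : ∀ t, q (t + 1) = max (q t + y t) 0) {t₀ : ℕ} (h0 : q t₀ = 0)
    {V C b U : ℝ} (hb : 0 ≤ b) (hU : (1 / 2) * b ^ 2 ≤ U) (n : ℕ)
    (hdec : ∀ t, t₀ ≤ t → t < t₀ + n →
      V * d t + q t * y t ≤ V * dstar t + q t * ystar t + C)
    (hy : ∀ t, t₀ ≤ t → t < t₀ + n → |y t| ≤ b ∧ |ystar t| ≤ b) :
    V * ∑ t ∈ Finset.Ico t₀ (t₀ + n), d t + q (t₀ + n) ^ 2 / 2
      ≤ V * ∑ t ∈ Finset.Ico t₀ (t₀ + n), dstar t + C * n + U * n ^ 2 := by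
  induction n with
  | zero => simp [h0]
  | succ n ih =>
    have ih' := ih (fun t h₁ h₂ => hdec t h₁ (by omega)) (fun t h₁ h₂ => hy t h₁ (by omega))
    obtain ⟨hq, hq'⟩ := virtualQueue_mem_Icc hrec h0 hb n
      fun t h₁ h₂ => (le_abs_self _).trans (hy t h₁ (by omega)).1
    have hd := hdec (t₀ + n) (by omega) (by omega)
    obtain ⟨hyn, hysn⟩ := hy (t₀ + n) (by omega) (by omega)
    have hdrift := max_add_zero_sq_le (q (t₀ + n)) (y (t₀ + n))
    have hysq : y (t₀ + n) ^ 2 ≤ b ^ 2 := sq_le_sq.2 (by rwa [abs_of_nonneg hb])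
    have hcross : q (t₀ + n) * ystar (t₀ + n) ≤ n * b * b :=
      (mul_le_mul_of_nonneg_left ((le_abs_self _).trans hysn) hq).trans
        (mul_le_mul_of_nonneg_right hq' hb)
    have hbU : (n : ℝ) * (1 / 2 * b ^ 2) ≤ n * U :=
      mul_le_mul_of_nonneg_left hU n.cast_nonneg
    rw [← add_assoc, Finset.sum_Ico_succ_top (by omega), Finset.sum_Ico_succ_top (by omega), hrec]
    push_cast
    linarith

/-- **Per-frame delay cost bound** (eq. (25) in the appendix). Under the hypotheses of
the per-frame key inequality with `V > 0`, the per-frame accumulated delay cost of the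
online algorithm satisfies `∑ d(t) ≤ J·D* + (U·J·(J+1) + C·J)/V`. -/
theorem per_frame_delay_cost_bound
    (y q d dstar ystar : ℕ → ℝ)
    (hrec : ∀ t, q (t + 1) = max (q t + y t) 0)
    (t₀ : ℕ) (h0 : q t₀ = 0)
    (V C : ℝ) (hV : 0 < V) (hC : 0 ≤ C)
    (J : ℕ) (hJ : 1 ≤ J)
    (Dstar y_max U : ℝ) (hy_max : 0 ≤ y_max) (hU : (1 / 2) * y_max ^ 2 ≤ U)
    (hdec : ∀ t, t₀ ≤ t → t < t₀ + J →
      V * d t + q t * y t ≤ V * dstar t + q t * ystar t + C)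
    (hy : ∀ t, t₀ ≤ t → t < t₀ + J → |y t| ≤ y_max ∧ |ystar t| ≤ y_max)
    (hbudget : ∑ t ∈ Finset.Ico t₀ (t₀ + J), ystar t ≤ 0)
    (hDstar : ∑ t ∈ Finset.Ico t₀ (t₀ + J), dstar t = J * Dstar) :
    ∑ t ∈ Finset.Ico t₀ (t₀ + J), d t
      ≤ J * Dstar + (U * J * (J + 1) + C * J) / V := by
  have hmain := drift_plus_penalty_le hrec h0 hy_max hU J hdec hy
  have hU0 : 0 ≤ U := le_trans (by positivity) hU
  have hUJ : 0 ≤ U * J := by positivity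
  rw [hDstar] at hmain
  rw [← sub_le_iff_le_add', le_div_iff₀ hV]
  linarith [sq_nonneg (q (t₀ + J))]
end
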